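/- arXiv:1506.04379 — 2 statements merged into one kernel-verified Lean document; each statement's English description precedes it below -/
import Mathlib

section
/- Let K be a countable algebraically closed subfield of ℂ and let x ∈ ℂ be transcendental over K. Then the orbit of x under the group Aut(ℂ/K) of field automorphisms of ℂ fixing K pointwise is exactly ℂ ∖ K; in particular, this orbit is uncountable. -/
theorem aux_exists_aut (K : Subfield ℂ) (x y : ℂ) (hx : Transcendental K x)
    (hy : Transcendental K y) : ∃ σ : ℂ ≃ₐ[K] ℂ, σ x = y := by
  classical
  have key : ∀ z : ℂ, Transcendental K z →
      ∃ t : Set ℂ, z ∈ t ∧ IsTranscendenceBasis K ((↑) : t → ℂ) := by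
    intro z hz
    have h : AlgebraicIndepOn K id ({z} : Set ℂ) :=
      (algebraicIndependent_singleton_iff (⟨z, rfl⟩ : ({z} : Set ℂ))).2 hz
    obtain ⟨t, ht, hb⟩ := exists_isTranscendenceBasis_superset h
    exact ⟨t, ht rfl, hb⟩
  obtain ⟨s, hxs, hs⟩ := key x hx
  obtain ⟨t, hyt, ht⟩ := key y hy
  obtain ⟨e0⟩ := Cardinal.eq.1 (hs.cardinalMk_eq ht)
  obtain ⟨e, he⟩ : ∃ e : s ≃ t, e ⟨x, hxs⟩ = ⟨y, hyt⟩ :=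
    ⟨e0.trans (Equiv.swap (e0 ⟨x, hxs⟩) ⟨y, hyt⟩), by simp⟩
  have := IsAlgClosed.isAlgClosure_of_transcendence_basis _ hs
  have := IsAlgClosed.isAlgClosure_of_transcendence_basis _ ht
  let f : Algebra.adjoin K (Set.range ((↑) : s → ℂ)) ≃ₐ[K]
      Algebra.adjoin K (Set.range ((↑) : t → ℂ)) :=
    (hs.1.aevalEquiv.symm.trans (MvPolynomial.renameEquiv K e)).trans ht.1.aevalEquiv
  let g : ℂ ≃+* ℂ := IsAlgClosure.equivOfEquiv ℂ ℂ f.toRingEquiv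
  have hg : ∀ a, g (algebraMap _ ℂ a) = algebraMap _ ℂ (f a) := fun a =>
    IsAlgClosure.equivOfEquiv_algebraMap ℂ ℂ f.toRingEquiv a
  refine ⟨AlgEquiv.ofRingEquiv (f := g) ?_, ?_⟩
  · intro r
    have := hg (algebraMap K _ r)
    rw [f.commutes] at this
    exact this
  · have h1 := hg (hs.1.aevalEquiv (MvPolynomial.X ⟨x, hxs⟩))
    have h2 : f (hs.1.aevalEquiv (MvPolynomial.X ⟨x, hxs⟩)) =
        ht.1.aevalEquiv (MvPolynomial.X ⟨y, hyt⟩) := by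
      simp [f, he]
    rw [h2, AlgebraicIndependent.algebraMap_aevalEquiv,
      AlgebraicIndependent.algebraMap_aevalEquiv] at h1
    have h3 : g x = y := by simpa using h1
    exact h3

/-- Let `K` be a countable algebraically closed subfield of `ℂ` and `x ∈ ℂ`
transcendental over `K`.  Then the orbit of `x` under `Aut(ℂ/K)` is exactly `ℂ \ K`;
in particular this orbit is uncountable. -/
theorem orbit_of_transcendental_eq_compl_and_uncountable
    (K : Subfield ℂ) (hK : Countable K) (hac : IsAlgClosed K)
    (x : ℂ) (hx : Transcendental K x) :
    {y : ℂ | ∃ σ : ℂ ≃ₐ[K] ℂ, σ x = y} = (K : Set ℂ)ᶜ ∧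
      ¬ ({y : ℂ | ∃ σ : ℂ ≃ₐ[K] ℂ, σ x = y}).Countable := by
  have h : {y : ℂ | ∃ σ : ℂ ≃ₐ[K] ℂ, σ x = y} = (K : Set ℂ)ᶜ := by
    ext y
    constructor
    · rintro ⟨σ, rfl⟩ hm
      have h1 : σ x = σ (algebraMap K ℂ ⟨σ x, hm⟩) := by
        rw [σ.commutes]; rfl
      apply hx
      rw [σ.injective h1]
      exact isAlgebraic_algebraMap _
    · intro hy
      refine aux_exists_aut K x y hx fun ha => hy ?_
      obtain ⟨a, rfl⟩ := minpoly.mem_range_of_degree_eq_one K y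
        (IsAlgClosed.degree_eq_one_of_irreducible K (minpoly.irreducible ha.isIntegral))
      exact a.2
  refine ⟨h, ?_⟩
  rw [h]
  intro hc
  have hu : (Set.univ : Set ℂ).Countable := by
    rw [← Set.union_compl_self (K : Set ℂ)]
    exact (Set.countable_coe_iff.1 hK).union hc
  exact not_countable_complex hu
end

section
/- Let K be a countable algebraically closed subfield of ℂ, let N be a positive integer, and let P = (x_1, …, x_N) ∈ ℂ^N be a point that does not belong to K^N. Then the orbit of P under the coordinatewise action of the group Aut(ℂ/K) of field automorphisms of ℂ fixing K pointwise is uncountable. -/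
theorem exists_algEquiv_perm_aux {R L ι : Type*} [CommRing R] [Field L] [Algebra R L]
    [IsAlgClosed L] (v : ι → L) (hv : IsTranscendenceBasis R v) (e : ι ≃ ι) :
    ∃ σ : L ≃ₐ[R] L, ∀ i, σ (v i) = v (e i) := by
  let _ := IsAlgClosed.isAlgClosure_of_transcendence_basis v hv
  let f : Algebra.adjoin R (Set.range v) ≃ₐ[R] Algebra.adjoin R (Set.range v) :=
    (hv.1.aevalEquiv.symm.trans (MvPolynomial.renameEquiv R e)).trans hv.1.aevalEquiv
  let g : L ≃+* L := IsAlgClosure.equivOfEquiv L L f.toRingEquiv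
  have hg : ∀ s : Algebra.adjoin R (Set.range v), g (algebraMap _ L s) = algebraMap _ L (f s) :=
    fun s => IsAlgClosure.equivOfEquiv_algebraMap L L f.toRingEquiv s
  refine ⟨AlgEquiv.ofRingEquiv (f := g) ?_, ?_⟩
  · intro r
    have := hg (algebraMap R _ r)
    rwa [f.commutes, ← IsScalarTower.algebraMap_apply] at this
  · intro i
    have h1 : ∀ j, algebraMap _ L (hv.1.aevalEquiv (MvPolynomial.X j)) = v j := by
      intro j
      rw [hv.1.algebraMap_aevalEquiv, MvPolynomial.aeval_X]
    have := hg (hv.1.aevalEquiv (MvPolynomial.X i))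
    have h2 : f (hv.1.aevalEquiv (MvPolynomial.X i)) = hv.1.aevalEquiv (MvPolynomial.X (e i)) := by
      simp [f]
    rw [h2, h1, h1] at this
    exact this

/-- Let `K` be a countable algebraically closed subfield of `ℂ`, `N` a positive integer,
and `P ∈ ℂ^N` a point not belonging to `K^N`.  Then the orbit of `P` under the
coordinatewise action of `Aut(ℂ/K)` is uncountable. -/
theorem orbit_uncountable_of_not_mem_power
    (K : Subfield ℂ) (hK : Countable K) (hac : IsAlgClosed K)
    (N : ℕ) (hN : 0 < N) (P : Fin N → ℂ) (hP : ¬ ∀ i, P i ∈ K) :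
    ¬ ({Q : Fin N → ℂ | ∃ σ : ℂ ≃ₐ[K] ℂ, ∀ i, σ (P i) = Q i}).Countable := by
  classical
  intro hc
  push Not at hP
  obtain ⟨i, hi⟩ := hP
  have htr : Transcendental K (P i) := by
    intro halg
    obtain ⟨a, ha⟩ := halg.isIntegral.mem_range_algebraMap_of_minpoly_splits (K := K)
      (by simpa using IsAlgClosed.splits (minpoly K (P i)))
    exact hi (ha ▸ a.2)
  have hs : AlgebraicIndepOn K id ({P i} : Set ℂ) :=
    algebraicIndependent_unique_type_iff.mpr htr
  obtain ⟨t, hst, ht⟩ := exists_isTranscendenceBasis_superset hs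
  have hx : P i ∈ t := hst rfl
  have hsub : t ⊆ (fun Q : Fin N → ℂ => Q i) ''
      {Q : Fin N → ℂ | ∃ σ : ℂ ≃ₐ[K] ℂ, ∀ i, σ (P i) = Q i} := by
    intro b hb
    obtain ⟨σ, hσ⟩ := exists_algEquiv_perm_aux _ ht (Equiv.swap ⟨P i, hx⟩ ⟨b, hb⟩)
    refine ⟨fun j => σ (P j), ⟨σ, fun _ => rfl⟩, ?_⟩
    simpa using hσ ⟨P i, hx⟩
  have htc : t.Countable := (hc.image _).mono hsub
  have h := IsAlgClosed.cardinal_le_max_transcendence_basis' _ ht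
  have h2 : Cardinal.mk ℂ ≤ Cardinal.aleph0 :=
    h.trans (max_le (max_le (Cardinal.mk_le_aleph0_iff.2 hK) (Cardinal.mk_le_aleph0_iff.2 htc.to_subtype)) le_rfl)
  rw [Cardinal.mk_complex] at h2
  exact absurd h2 (not_le.2 Cardinal.aleph0_lt_continuum)
end
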